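/- Let G be a connected block graph on n vertices with blocks of orders b_1,…,b_t, and let 2 ≤ k < n−1. Then SW_k(G) ≥ (n−1)·C(n−1,k−1) − ∑_{i=1}^t C(b_i−1, k), with equality if and only if G is the star-like block graph (all blocks sharing a common universal vertex). -/

import Mathlib

open SimpleGraph Finset
open scoped Classical

/-- The Steiner distance of a vertex set `S` in `G`: the minimum number of edges of a
connected subgraph of `G` whose vertex set contains `S`. -/
noncomputable def steinerDist {V : Type*} (G : SimpleGraph V) (S : Set V) : ℕ :=
  sInf {m | ∃ H : G.Subgraph, H.Connected ∧ S ⊆ H.verts ∧ H.edgeSet.ncard = m}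

/-- The Steiner `k`-Wiener index: the sum of Steiner distances over all `k`-element
vertex subsets. -/
noncomputable def steinerWiener {V : Type*} [Fintype V] (G : SimpleGraph V) (k : ℕ) : ℕ :=
  ∑ S ∈ Finset.powersetCard k (Finset.univ : Finset V), steinerDist G (↑S : Set V)

/-- `v` is a cut vertex of `G`: `G` is connected but deleting `v` disconnects it. -/
def IsCutVertex {V : Type*} (G : SimpleGraph V) (v : V) : Prop :=
  G.Connected ∧ ¬ (G.induce {u | u ≠ v}).Connected

/-- The induced subgraph on `B` is connected and has no cut vertex. -/
def IsBiconnectedSet {V : Type*} (G : SimpleGraph V) (B : Set V) : Prop :=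
  (G.induce B).Connected ∧
    ∀ v ∈ B, (B \ {v}).Nonempty → (G.induce (B \ {v})).Connected

/-- `B` is a block of `G`: a maximal set inducing a connected subgraph without cut
vertex (with at least two vertices). -/
def IsBlock {V : Type*} (G : SimpleGraph V) (B : Set V) : Prop :=
  2 ≤ B.ncard ∧ IsBiconnectedSet G B ∧
    ∀ B' : Set V, B ⊆ B' → 2 ≤ B'.ncard → IsBiconnectedSet G B' → B' = B

/-- A block graph: a connected graph in which every block is a clique. -/
def IsBlockGraph {V : Type*} (G : SimpleGraph V) : Prop :=
  G.Connected ∧ ∀ B : Set V, IsBlock G B → G.IsClique B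

namespace SimpleGraph

variable {V : Type*} {G : SimpleGraph V}

lemma Connected.exists_walk_subset {W : Set V} (h : (G.induce W).Connected) {a b : V}
    (ha : a ∈ W) (hb : b ∈ W) : ∃ w : G.Walk a b, ∀ x ∈ w.support, x ∈ W := by
  obtain ⟨w⟩ := h.preconnected ⟨a, ha⟩ ⟨b, hb⟩
  refine ⟨w.map (Embedding.induce W).toHom, fun x hx => ?_⟩
  erw [Walk.support_map, List.mem_map] at hx
  obtain ⟨y, _, rfl⟩ := hx
  exact y.2

lemma induce_connected_of_walks {W : Set V} {a : V} (ha : a ∈ W)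
    (h : ∀ b ∈ W, ∃ w : G.Walk a b, ∀ x ∈ w.support, x ∈ W) : (G.induce W).Connected := by
  refine induce_connected_of_patches a ha fun {b} hb => ?_
  obtain ⟨w, hw⟩ := h b hb
  exact ⟨W, subset_rfl, ha, hb, ⟨w.induce W hw⟩⟩

lemma IsClique.induce_connected {W : Set V} (h : G.IsClique W) (hW : W.Nonempty) :
    (G.induce W).Connected := by
  obtain ⟨a, ha⟩ := hW
  refine induce_connected_of_walks ha fun b hb => ?_
  by_cases hab : a = b
  · subst hab
    exact ⟨.nil, by simpa using ha⟩
  · exact ⟨(h ha hb hab).toWalk, by simp [Adj.toWalk, ha, hb]⟩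

lemma IsClique.isBiconnectedSet {W : Set V} (h : G.IsClique W) (hW : W.Nonempty) :
    IsBiconnectedSet G W :=
  ⟨h.induce_connected hW, fun _ _ hne => (h.subset Set.sdiff_subset).induce_connected hne⟩

/-- Removing a vertex from a path leaves every other vertex joined to one of the ends. -/
lemma Walk.IsPath.exists_walk_end_avoiding {a b v x : V} {p : G.Walk a b} (hp : p.IsPath)
    (hx : x ∈ p.support) (hxv : x ≠ v) :
    (∃ w : G.Walk a x, w.support ⊆ p.support ∧ v ∉ w.support) ∨
      ∃ w : G.Walk b x, w.support ⊆ p.support ∧ v ∉ w.support := by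
  by_cases hv : v ∈ (p.takeUntil x hx).support
  · right
    refine ⟨(p.dropUntil x hx).reverse, ?_, ?_⟩
    · intro y hy
      rw [support_reverse, List.mem_reverse] at hy
      exact p.support_dropUntil_subset_support hx hy
    · rw [support_reverse, List.mem_reverse]
      intro hv'
      have hnd := hp.support_nodup
      rw [← p.take_spec hx, support_append, List.nodup_append'] at hnd
      refine hnd.2.2 hv ?_
      rw [← cons_tail_support] at hv'
      exact (List.mem_cons.1 hv').resolve_left (Ne.symm hxv)
  · exact Or.inl ⟨_, p.support_takeUntil_subset_support hx, hv⟩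

lemma isBiconnectedSet_insert_path {z a b : V} (ha : G.Adj z a) (hb : G.Adj z b)
    {p : G.Walk a b} (hp : p.IsPath) (hz : z ∉ p.support) :
    IsBiconnectedSet G (insert z {x | x ∈ p.support}) := by
  have hcover : ∀ v, v ≠ z → ∀ x ∈ p.support, x ≠ v → ∃ w : G.Walk z x,
      ∀ y ∈ w.support, y ∈ insert z {x | x ∈ p.support} \ {v} := by
    intro v hvz x hx hxv
    have key : ∀ {c : V}, G.Adj z c → ∀ w : G.Walk c x, w.support ⊆ p.support → v ∉ w.support →
        ∃ w : G.Walk z x, ∀ y ∈ w.support, y ∈ insert z {x | x ∈ p.support} \ {v} := by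
      intro c hc w hw hv
      refine ⟨.cons hc w, fun y hy => ?_⟩
      rw [Walk.support_cons, List.mem_cons] at hy
      rcases hy with rfl | hy
      · exact ⟨Set.mem_insert _ _, Ne.symm hvz⟩
      · exact ⟨Set.mem_insert_of_mem _ (hw hy), fun h => hv (h ▸ hy)⟩
    rcases hp.exists_walk_end_avoiding hx hxv with ⟨w, hw, hv⟩ | ⟨w, hw, hv⟩
    · exact key ha w hw hv
    · exact key hb w hw hv
  have hsub : ∀ x ∈ p.support, ∃ w : G.Walk a x, w.support ⊆ p.support := fun x hx =>
    ⟨p.takeUntil x hx, p.support_takeUntil_subset_support hx⟩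
  refine ⟨induce_connected_of_walks (Set.mem_insert z _) fun x hx => ?_, fun v hv _ => ?_⟩
  · rcases hx with rfl | hx
    · exact ⟨.nil, by simp⟩
    · obtain ⟨w, hw⟩ := hsub x hx
      refine ⟨.cons ha w, fun y hy => ?_⟩
      rw [Walk.support_cons, List.mem_cons] at hy
      exact hy.imp id fun h => hw h
  · by_cases hvz : v = z
    · subst hvz
      have ha' : a ∈ insert v {x | x ∈ p.support} \ {v} :=
        ⟨Set.mem_insert_of_mem _ p.start_mem_support, fun h => hz (h ▸ p.start_mem_support)⟩
      refine induce_connected_of_walks ha' fun x hx => ?_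
      obtain ⟨w, hw⟩ := hsub x (hx.1.resolve_left hx.2)
      exact ⟨w, fun y hy => ⟨Set.mem_insert_of_mem _ (hw hy), fun h => hz (h ▸ hw hy)⟩⟩
    · refine induce_connected_of_walks (a := z) ⟨Set.mem_insert _ _, Ne.symm hvz⟩ fun x hx => ?_
      rcases hx.1 with rfl | hx'
      · exact ⟨.nil, by simp [Ne.symm hvz]⟩
      · exact hcover v hvz x hx' hx.2

lemma exists_isBlock_superset [Finite V] {W : Set V} (hcard : 2 ≤ W.ncard)
    (h : IsBiconnectedSet G W) : ∃ B, IsBlock G B ∧ W ⊆ B := by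
  obtain ⟨B, hWB, hB⟩ := (Set.toFinite {B : Set V | IsBiconnectedSet G B}).exists_le_maximal h
  refine ⟨B, ⟨hcard.trans (Set.ncard_le_ncard hWB), hB.prop, fun B' hBB' _ hB' => ?_⟩, hWB⟩
  exact (hB.eq_of_subset hB' hBB').symm

end SimpleGraph

open SimpleGraph

lemma IsBlockGraph.isClique_of_isBiconnectedSet {V : Type*} [Finite V] {G : SimpleGraph V}
    (hG : IsBlockGraph G) {W : Set V} (h : IsBiconnectedSet G W) : G.IsClique W := by
  by_cases hcard : 2 ≤ W.ncard
  · obtain ⟨B, hB, hWB⟩ := exists_isBlock_superset hcard h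
    exact (hG.2 B hB).subset hWB
  · have : W.Subsingleton := by
      rw [← Set.ncard_le_one_iff_subsingleton]
      omega
    exact this.pairwise _

/-- In a block graph, two neighbours of `z` which are joined by a walk avoiding `z` are
adjacent. -/
lemma IsBlockGraph.adj_of_walk_avoiding {V : Type*} [Finite V] {G : SimpleGraph V}
    (hG : IsBlockGraph G) {z a b : V} (ha : G.Adj z a) (hb : G.Adj z b) (hab : a ≠ b)
    (w : G.Walk a b) (hw : z ∉ w.support) : G.Adj a b := by
  refine hG.isClique_of_isBiconnectedSet (isBiconnectedSet_insert_path ha hb w.bypass_isPath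
    fun h => hw (w.support_bypass_subset_support h)) ?_ ?_ hab
  · exact Set.mem_insert_of_mem _ (Walk.start_mem_support _)
  · exact Set.mem_insert_of_mem _ (Walk.end_mem_support _)

namespace SimpleGraph

variable {V : Type*} {G : SimpleGraph V}

lemma exists_connected_superset_ncard_le [Finite V] (hG : G.Connected) (S : Set V) :
    ∃ W : Set V, S ⊆ W ∧ (G.induce W).Connected ∧ W.ncard ≤ steinerDist G S + 1 := by
  have hne : {m | ∃ H : G.Subgraph, H.Connected ∧ S ⊆ H.verts ∧ H.edgeSet.ncard = m}.Nonempty :=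
    ⟨_, ⊤, Subgraph.Connected.mk (Subgraph.topIso.connected_iff.2 hG), Set.subset_univ _, rfl⟩
  obtain ⟨H, hH, hS, hcard⟩ := Nat.sInf_mem hne
  refine ⟨H.verts, hS, hH.induce_verts, ?_⟩
  have h := hH.coe.card_vert_le_card_edgeSet_add_one
  rw [Nat.card_coe_set_eq, Nat.card_coe_set_eq] at h
  refine h.trans (Nat.add_le_add_right ?_ 1)
  rw [steinerDist, ← hcard, ← H.image_coe_edgeSet_coe,
    Set.ncard_image_of_injective _ (Sym2.map.injective Subtype.val_injective)]

lemma steinerDist_add_one_le_ncard [Finite V] {S W : Set V} (hSW : S ⊆ W)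
    (hW : (G.induce W).Connected) : steinerDist G S + 1 ≤ W.ncard := by
  obtain ⟨T, hT, hTree⟩ := hW.exists_isTree_le
  let H : G.Subgraph :=
    { verts := W
      Adj := fun a b => ∃ (ha : a ∈ W) (hb : b ∈ W), T.Adj ⟨a, ha⟩ ⟨b, hb⟩
      adj_sub := fun ⟨ha, hb, h⟩ => hT h
      edge_vert := fun ⟨ha, _, _⟩ => ha
      symm := ⟨fun _ _ ⟨ha, hb, h⟩ => ⟨hb, ha, h.symm⟩⟩ }
  have hco : H.coe = T := by
    ext a b
    exact ⟨fun ⟨_, _, h⟩ => h, fun h => ⟨a.2, b.2, h⟩⟩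
  have hconn : H.Connected := ⟨by rw [hco]; exact hTree.connected⟩
  have hcard : H.edgeSet.ncard + 1 = W.ncard := by
    rw [← H.image_coe_edgeSet_coe,
      Set.ncard_image_of_injective _ (Sym2.map.injective Subtype.val_injective), hco,
      ← Nat.card_coe_set_eq, ← Nat.card_coe_set_eq]
    exact (isTree_iff_connected_and_card.1 hTree).2
  rw [← hcard]
  refine Nat.add_le_add_right (Nat.sInf_le ?_) 1
  exact ⟨H, hconn, hSW, rfl⟩

end SimpleGraph

namespace SimpleGraph

variable {V : Type*} {G : SimpleGraph V}

lemma Connected.exists_parent (hG : G.Connected) (r : V) :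
    ∃ p : V → V, ∀ y, y ≠ r → G.Adj y (p y) ∧ G.dist r (p y) + 1 = G.dist r y := by
  refine ⟨fun y => if h : ∃ z, G.Adj y z ∧ G.dist r z + 1 = G.dist r y then h.choose else y,
    fun y hy => ?_⟩
  have h : ∃ z, G.Adj y z ∧ G.dist r z + 1 = G.dist r y := by
    obtain ⟨w, hw⟩ := hG.exists_walk_length_eq_dist y r
    cases w with
    | nil => exact absurd rfl hy
    | @cons _ z _ hyz q =>
      refine ⟨z, hyz, ?_⟩
      rw [Walk.length_cons] at hw
      have h1 := dist_le q
      have h2 := hG.dist_triangle (u := y) (v := z) (w := r)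
      rw [dist_eq_one_iff_adj.2 hyz] at h2
      rw [dist_comm (u := r), dist_comm (u := r)]
      omega
  simp only [dif_pos h]
  exact h.choose_spec

lemma Connected.exists_walk_descending (hG : G.Connected) (r u : V) :
    ∃ w : G.Walk u r, ∀ x ∈ w.support, x = u ∨ G.dist r x < G.dist r u := by
  obtain ⟨p, hp⟩ := hG.exists_parent r
  induction hd : G.dist r u using Nat.strong_induction_on generalizing u with
  | _ d ih =>
    by_cases hu : u = r
    · subst hu
      exact ⟨.nil, by simp⟩
    · obtain ⟨hadj, hdist⟩ := hp u hu
      obtain ⟨w, hw⟩ := ih _ (by omega) (p u) rfl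
      refine ⟨.cons hadj w, fun x hx => ?_⟩
      rw [Walk.support_cons, List.mem_cons] at hx
      rcases hx with rfl | hx
      · exact Or.inl rfl
      · right
        rcases hw x hx with rfl | h <;> omega

end SimpleGraph

namespace IsBlockGraph

variable {V : Type*} {G : SimpleGraph V}

/-- In a block graph, the parent `z` of `y` towards `r` separates `y` from all other vertices
closer to `r` than `y`. -/
lemma dist_le_of_walk_avoiding [Finite V] (hG : IsBlockGraph G) {r y z u : V} (hyz : G.Adj y z)
    (hd : G.dist r z + 1 = G.dist r y) (w : G.Walk y u) (hw : z ∉ w.support) :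
    G.dist r y ≤ G.dist r u := by
  by_contra! hlt
  have huz : u ≠ z := fun h => hw (h ▸ w.end_mem_support)
  have hzr : z ≠ r := by
    rintro rfl
    rw [dist_self] at hd
    exact huz (hG.1.dist_eq_zero_iff.1 (by omega)).symm
  obtain ⟨p, hp⟩ := hG.1.exists_parent r
  obtain ⟨hadj, hdist⟩ := hp z hzr
  obtain ⟨w₁, hw₁⟩ := hG.1.exists_walk_descending r u
  obtain ⟨w₂, hw₂⟩ := hG.1.exists_walk_descending r (p z)
  have hne : y ≠ p z := by
    intro h
    rw [← h] at hdist
    omega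
  have hyp : G.Adj y (p z) := by
    refine hG.adj_of_walk_avoiding hyz.symm hadj hne (w.append (w₁.append w₂.reverse)) ?_
    rw [Walk.mem_support_append_iff, Walk.mem_support_append_iff, Walk.support_reverse,
      List.mem_reverse]
    rintro (h | h | h)
    · exact hw h
    · rcases hw₁ z h with h | h
      · exact huz h.symm
      · omega
    · rcases hw₂ z h with h | h
      · exact hadj.ne h
      · omega
  have := hG.1.dist_triangle (u := r) (v := p z) (w := y)
  rw [dist_eq_one_iff_adj.2 hyp.symm] at this
  omega

lemma dist_le_of_connected [Finite V] (hG : IsBlockGraph G) {r y z u : V} {W : Set V}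
    (hW : (G.induce W).Connected) (hyz : G.Adj y z) (hd : G.dist r z + 1 = G.dist r y)
    (hy : y ∈ W) (hu : u ∈ W) (hz : z ∉ W) : G.dist r y ≤ G.dist r u := by
  obtain ⟨w, hw⟩ := hW.exists_walk_subset hy hu
  exact hG.dist_le_of_walk_avoiding hyz hd w fun h => hz (hw z h)

/-- A connected vertex set of size at least two either has a vertex `x` which is the deepest
parent, with respect to the root `r`, missing from the rest of the set, or it lies in a
block which has a vertex closer to `r` than the whole set. -/
lemma exists_deepest_parent_or_subset_block [Finite V] (hG : IsBlockGraph G) {r : V} {p : V → V}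
    (hp : ∀ y, y ≠ r → G.Adj y (p y) ∧ G.dist r (p y) + 1 = G.dist r y)
    {S : Set V} (hS : (G.induce S).Connected) (hnt : S.Nontrivial) :
    (∃ x ∈ S, (r ∈ S → r = x) ∧ (∃ y ∈ S, y ≠ x ∧ p y = x) ∧
      ∀ y ∈ S, y ≠ x → p y ∈ S ∨ G.dist r (p y) < G.dist r x) ∨
    ∃ B, IsBlock G B ∧ S ⊆ B ∧ ∃ z ∈ B, ∀ y ∈ S, G.dist r z < G.dist r y := by
  have sep : ∀ y ∈ S, y ≠ r → p y ∉ S → ∀ u ∈ S, G.dist r y ≤ G.dist r u := fun y hy hyr hpy u hu =>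
    hG.dist_le_of_connected hS (hp y hyr).1 (hp y hyr).2 hy hu hpy
  by_cases hex : ∃ y ∈ S, y ≠ r ∧ p y ∈ S
  · left
    obtain ⟨y, ⟨hyS, hyr, hpy⟩, hmin⟩ := Set.exists_min_image {y | y ∈ S ∧ y ≠ r ∧ p y ∈ S}
      (G.dist r) (Set.toFinite _) hex
    obtain ⟨hadj, hdist⟩ := hp y hyr
    have hroot : r ∈ S → r = p y := by
      intro hr
      by_contra hne
      have hne' : p y ≠ r := Ne.symm hne
      have hpp : p (p y) ∈ S := by
        by_contra hpp
        have h0 := sep _ hpy hne' hpp r hr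
        have h1 := (hp _ hne').2
        rw [dist_self] at h0
        omega
      have := hmin (p y) ⟨hpy, hne', hpp⟩
      omega
    refine ⟨p y, hpy, hroot, ⟨y, hyS, hadj.ne, rfl⟩, fun y' hy' hne => ?_⟩
    by_contra! hcon
    have hy'r : y' ≠ r := by
      rintro rfl
      exact hne (hroot hy')
    have h1 := sep y' hy' hy'r hcon.1 _ hpy
    have h2 := (hp y' hy'r).2
    omega
  · right
    push Not at hex
    have hrS : r ∉ S := by
      intro hr
      obtain ⟨a, ha, har⟩ := hnt.exists_ne r
      have h0 := sep a ha har (hex a ha har) r hr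
      have h1 := (hp a har).2
      rw [dist_self] at h0
      omega
    have hne : ∀ y ∈ S, y ≠ r := fun y hy h => hrS (h ▸ hy)
    have hle : ∀ a ∈ S, ∀ b ∈ S, G.dist r a ≤ G.dist r b := fun a ha b hb =>
      sep a ha (hne a ha) (hex a ha (hne a ha)) b hb
    have hstep : ∀ a ∈ S, ∀ b ∈ S, G.Adj a b → p a = p b := by
      intro a ha b hb hab
      by_contra hpab
      obtain ⟨ha1, ha2⟩ := hp a (hne a ha)
      obtain ⟨hb1, hb2⟩ := hp b (hne b hb)
      have hpa : p a ∉ S := hex a ha (hne a ha)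
      have h := hG.dist_le_of_walk_avoiding ha1 ha2 (.cons hab (.cons hb1 .nil)) (by
        simp only [Walk.support_cons, Walk.support_nil, List.mem_cons, List.not_mem_nil, or_false]
        rintro (h | h | h)
        · exact hpa (h.symm.subst (motive := (· ∈ S)) ha)
        · exact hpa (h ▸ hb)
        · exact hpab h)
      have := hle b hb a ha
      omega
    have hconst : ∀ {a b : V} (w : G.Walk a b), (∀ x ∈ w.support, x ∈ S) → p a = p b := by
      intro a b w
      induction w with
      | nil => intro _; rfl
      | @cons u v _ h q ih =>
        intro hw
        simp only [Walk.support_cons, List.mem_cons, forall_eq_or_imp] at hw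
        exact (hstep u hw.1 v (hw.2 v q.start_mem_support) h).trans (ih hw.2)
    obtain ⟨a, ha⟩ := hnt.nonempty
    have hpar : ∀ b ∈ S, p b = p a := by
      intro b hb
      obtain ⟨w, hw⟩ := hS.exists_walk_subset hb ha
      exact hconst w hw
    have hz : p a ∉ S := hex a ha (hne a ha)
    have hzadj : ∀ b ∈ S, G.Adj (p a) b := fun b hb => hpar b hb ▸ (hp b (hne b hb)).1.symm
    have hclique : G.IsClique (insert (p a) S) := by
      rw [isClique_insert]
      refine ⟨fun b hb c hc hbc => ?_, fun b hb _ => hzadj b hb⟩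
      obtain ⟨w, hw⟩ := hS.exists_walk_subset hb hc
      exact hG.adj_of_walk_avoiding (hzadj b hb) (hzadj c hc) hbc w fun h => hz (hw _ h)
    have hcard : 2 ≤ (insert (p a) S).ncard :=
      (Set.one_lt_ncard_iff_nontrivial).2 (hnt.mono (Set.subset_insert _ _))
    obtain ⟨B, hB, hSB⟩ :=
      exists_isBlock_superset hcard (hclique.isBiconnectedSet (Set.insert_nonempty _ _))
    refine ⟨B, hB, (Set.subset_insert _ _).trans hSB, p a, hSB (Set.mem_insert _ _), ?_⟩
    intro y hy
    have := (hp y (hne y hy)).2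
    rw [hpar y hy] at this
    omega

end IsBlockGraph

namespace IsBlockGraph

variable {V : Type*} {G : SimpleGraph V}

/-- An upper bound for the number of connected `k`-subsets of a block graph. -/
lemma card_connected_le [Fintype V] (hG : IsBlockGraph G) {t : ℕ} {Bl : Fin t → Set V}
    (hB : ∀ i, IsBlock G (Bl i)) (hall : ∀ C : Set V, IsBlock G C → ∃ i, C = Bl i)
    {k : ℕ} (hk : 2 ≤ k) :
    #((powersetCard k univ).filter fun S : Finset V => (G.induce (S : Set V)).Connected) ≤
      (Fintype.card V - 1).choose (k - 1) + ∑ i : Fin t, ((Bl i).ncard - 1).choose k := by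
  obtain ⟨r⟩ := hG.1.nonempty
  obtain ⟨p, hp⟩ := hG.1.exists_parent r
  have hmin : ∀ i, ∃ c ∈ Bl i, ∀ x ∈ Bl i, G.dist r c ≤ G.dist r x := fun i =>
    Set.exists_min_image _ _ (Set.toFinite _) (Set.nonempty_of_ncard_ne_zero
      (by have := (hB i).1; omega))
  choose c hc hcmin using hmin
  let P : V → Finset V → Prop := fun x T =>
    (∃ y ∈ T, p y = x) ∧ ∀ y ∈ T, p y = x ∨ p y ∈ T ∨ G.dist r (p y) < G.dist r x
  have huniq : ∀ {x x' T}, P x T → P x' T → x ∉ T → x' ∉ T → x = x' := by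
    rintro x x' T ⟨⟨y, hy, rfl⟩, h1⟩ ⟨⟨y', hy', rfl⟩, h2⟩ hx hx'
    rcases h1 y' hy' with h | h | h
    · exact h.symm
    · exact absurd h hx'
    · rcases h2 y hy with h' | h' | h'
      · exact h'
      · exact absurd h' hx
      · omega
  let F : Finset V → Finset V := fun T =>
    if h : ∃ x, P x T ∧ x ∉ T then insert h.choose T else T
  have hF : ∀ {x T}, P x T → x ∉ T → F T = insert x T := by
    intro x T hx hxT
    have h : ∃ x, P x T ∧ x ∉ T := ⟨x, hx, hxT⟩
    simp only [F, dif_pos h]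
    rw [huniq h.choose_spec.1 hx h.choose_spec.2 hxT]
  have hsub : ((powersetCard k univ).filter fun S : Finset V => (G.induce (S : Set V)).Connected) ⊆
      (powersetCard (k - 1) (univ.erase r)).image F ∪
        univ.biUnion fun i => powersetCard k ((Bl i).toFinset.erase (c i)) := by
    intro S hS
    simp only [mem_filter, mem_powersetCard, subset_univ, true_and] at hS
    obtain ⟨hSk, hS⟩ := hS
    have hnt : (S : Set V).Nontrivial := by
      refine one_lt_card_iff_nontrivial.1 ?_
      omega
    rw [mem_union]
    rcases hG.exists_deepest_parent_or_subset_block hp hS hnt with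
      ⟨x, hx, hr, ⟨y, hy, hyx, hpy⟩, hdeep⟩ | ⟨B, hBB, hSB, z, hz, hlt⟩
    · left
      refine mem_image.2 ⟨S.erase x, ?_, ?_⟩
      · rw [mem_powersetCard, card_erase_of_mem (by exact hx), hSk]
        refine ⟨fun a ha => mem_erase.2 ⟨?_, mem_univ _⟩, rfl⟩
        rintro rfl
        exact (mem_erase.1 ha).1 (hr (mem_erase.1 ha).2)
      · rw [hF (x := x) ⟨⟨y, mem_erase.2 ⟨hyx, hy⟩, hpy⟩, fun a ha => ?_⟩ (notMem_erase _ _)]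
        · exact insert_erase (by exact hx)
        · obtain ⟨hax, haS⟩ := mem_erase.1 ha
          by_cases h : p a = x
          · exact Or.inl h
          · exact Or.inr ((hdeep a haS hax).imp (fun h' => mem_erase.2 ⟨h, h'⟩) id)
    · right
      obtain ⟨i, rfl⟩ := hall B hBB
      refine mem_biUnion.2 ⟨i, mem_univ _, mem_powersetCard.2 ⟨fun a ha => ?_, hSk⟩⟩
      refine mem_erase.2 ⟨?_, Set.mem_toFinset.2 (hSB ha)⟩
      rintro rfl
      have h1 := hlt _ ha
      have h2 := hcmin i z hz
      omega
  refine (card_le_card hsub).trans ((card_union_le _ _).trans (add_le_add ?_ ?_))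
  · refine card_image_le.trans ?_
    rw [card_powersetCard, card_erase_of_mem (mem_univ _), card_univ]
  · refine card_biUnion_le.trans (sum_le_sum fun i _ => ?_)
    rw [card_powersetCard, card_erase_of_mem (Set.mem_toFinset.2 (hc i)),
      Set.ncard_eq_toFinset_card']

/-- A universal vertex of a block graph lies in every block. -/
lemma mem_of_isBlock [Finite V] (hG : IsBlockGraph G) {v : V} (hv : ∀ u, u ≠ v → G.Adj v u)
    {B : Set V} (hB : IsBlock G B) : v ∈ B := by
  have hcl : G.IsClique (insert v B) := by
    rw [isClique_insert]
    exact ⟨hG.2 B hB, fun b _ hb => hv b hb.symm⟩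
  have h := hB.2.2 _ (Set.subset_insert v B)
    (hB.1.trans (Set.ncard_le_ncard (Set.subset_insert v B)))
    (hcl.isBiconnectedSet (Set.insert_nonempty _ _))
  rw [← h]
  exact Set.mem_insert _ _

/-- Two blocks of a block graph with a universal vertex `v` sharing another vertex coincide. -/
lemma eq_of_mem_of_mem [Finite V] (hG : IsBlockGraph G) {v : V} (hv : ∀ u, u ≠ v → G.Adj v u)
    {B C : Set V} (hB : IsBlock G B) (hC : IsBlock G C) {w : V} (hwv : w ≠ v) (hwB : w ∈ B)
    (hwC : w ∈ C) : B = C := by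
  have hcross : ∀ a ∈ B, ∀ b ∈ C, a ≠ b → G.Adj a b := by
    intro a ha b hb hab
    by_cases hav : a = v
    · subst hav
      exact hv b hab.symm
    by_cases hbv : b = v
    · subst hbv
      exact (hv a hab).symm
    by_cases haw : a = w
    · subst haw
      exact hG.2 C hC hwC hb hab
    by_cases hbw : b = w
    · subst hbw
      exact hG.2 B hB ha hwB hab
    refine hG.adj_of_walk_avoiding (hv a hav) (hv b hbv) hab
      (.cons (hG.2 B hB ha hwB haw) (.cons (hG.2 C hC hwC hb (Ne.symm hbw)) .nil)) ?_
    simp [Ne.symm hav, Ne.symm hbv, hwv.symm]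
  have hcl : G.IsClique (B ∪ C) := by
    rintro a (ha | ha) b (hb | hb) hab
    · exact hG.2 B hB ha hb hab
    · exact hcross a ha b hb hab
    · exact (hcross b hb a ha hab.symm).symm
    · exact hG.2 C hC ha hb hab
  have hbi := hcl.isBiconnectedSet ⟨w, Or.inl hwB⟩
  rw [← hB.2.2 _ Set.subset_union_left
      (hB.1.trans (Set.ncard_le_ncard Set.subset_union_left)) hbi]
  exact hC.2.2 _ Set.subset_union_right
    (hC.1.trans (Set.ncard_le_ncard Set.subset_union_right)) hbi

/-- The bound of `card_connected_le` is attained when there is a universal vertex. -/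
lemma le_card_connected [Fintype V] (hG : IsBlockGraph G) {v : V} (hv : ∀ u, u ≠ v → G.Adj v u)
    {t : ℕ} {Bl : Fin t → Set V} (hB : ∀ i, IsBlock G (Bl i)) (hinj : Function.Injective Bl)
    {k : ℕ} (hk : 2 ≤ k) :
    (Fintype.card V - 1).choose (k - 1) + ∑ i : Fin t, ((Bl i).ncard - 1).choose k ≤
      #((powersetCard k univ).filter fun S : Finset V => (G.induce (S : Set V)).Connected) := by
  have hsub : (powersetCard (k - 1) (univ.erase v)).image (insert v) ∪
        univ.biUnion (fun i => powersetCard k ((Bl i).toFinset.erase v)) ⊆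
      ((powersetCard k univ).filter fun S : Finset V => (G.induce (S : Set V)).Connected) := by
    intro S hS
    simp only [mem_filter, mem_powersetCard, subset_univ, true_and]
    rcases mem_union.1 hS with h | h
    · obtain ⟨T, hT, rfl⟩ := mem_image.1 h
      obtain ⟨hTv, hTk⟩ := mem_powersetCard.1 hT
      refine ⟨?_, ?_⟩
      · rw [card_insert_of_notMem fun h => (mem_erase.1 (hTv h)).1 rfl]
        omega
      · refine induce_connected_of_walks (a := v) (by simp) fun b hb => ?_
        by_cases hbv : b = v
        · subst hbv
          exact ⟨.nil, by simp⟩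
        · refine ⟨(hv b hbv).toWalk, ?_⟩
          simpa [Adj.toWalk, hbv] using hb
    · obtain ⟨i, _, hi⟩ := mem_biUnion.1 h
      obtain ⟨hSi, hSk⟩ := mem_powersetCard.1 hi
      refine ⟨hSk, IsClique.induce_connected ((hG.2 _ (hB i)).subset fun a ha => ?_) ?_⟩
      · exact Set.mem_toFinset.1 (mem_of_mem_erase (hSi ha))
      · rw [coe_nonempty, ← card_pos]
        omega
  refine le_trans (Eq.le ?_) (card_le_card hsub)
  rw [card_union_of_disjoint, card_image_of_injOn, card_powersetCard,
    card_erase_of_mem (mem_univ _), card_univ, card_biUnion]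
  · congr 1
    refine sum_congr rfl fun i _ => ?_
    rw [card_powersetCard, card_erase_of_mem
      (Set.mem_toFinset.2 (hG.mem_of_isBlock hv (hB i))), Set.ncard_eq_toFinset_card']
  · intro i _ j _ hij
    refine Finset.disjoint_left.2 ?_
    intro S hi hj
    obtain ⟨hSi, hSk⟩ := mem_powersetCard.1 hi
    obtain ⟨hSj, _⟩ := mem_powersetCard.1 hj
    obtain ⟨w, hw⟩ := card_pos.1 (show 0 < #S by omega)
    obtain ⟨hwv, hwi⟩ := mem_erase.1 (hSi hw)
    exact hij (hinj (hG.eq_of_mem_of_mem hv (hB i) (hB j) hwv (Set.mem_toFinset.1 hwi)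
      (Set.mem_toFinset.1 (mem_of_mem_erase (hSj hw)))))
  · intro S hS T hT hST
    have key : ∀ {S : Finset V}, S ∈ (powersetCard (k - 1) (univ.erase v) : Finset (Finset V)) →
        v ∉ S := fun hS h => (mem_erase.1 ((mem_powersetCard.1 hS).1 h)).1 rfl
    rw [← erase_insert (key hS), ← erase_insert (key hT)]
    exact congrArg (·.erase v) hST
  · rw [Finset.disjoint_left]
    intro S h h'
    obtain ⟨T, _, rfl⟩ := mem_image.1 h
    obtain ⟨i, _, hi⟩ := mem_biUnion.1 h'
    exact (mem_erase.1 ((mem_powersetCard.1 hi).1 (mem_insert_self v T))).1 rfl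

/-- A block graph of diameter at most two has a universal vertex. -/
lemma exists_universal_of_dist_le_two [Finite V] (hG : IsBlockGraph G)
    (h : ∀ a b, G.dist a b ≤ 2) : ∃ v, ∀ u, u ≠ v → G.Adj v u := by
  obtain ⟨r⟩ := hG.1.nonempty
  obtain ⟨p, hp⟩ := hG.1.exists_parent r
  by_cases hr : ∀ u, u ≠ r → G.Adj r u
  · exact ⟨r, hr⟩
  push Not at hr
  obtain ⟨d, hdr, hd⟩ := hr
  have hdist : G.dist r d = 2 := by
    have h0 := hG.1.pos_dist_of_ne hdr.symm
    have h1 : G.dist r d ≠ 1 := fun h => hd (dist_eq_one_iff_adj.1 h)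
    have h2 := h r d
    omega
  obtain ⟨hadj, hpd⟩ := hp d hdr
  refine ⟨p d, fun x hx => ?_⟩
  by_contra hnadj
  have hcr : p d ≠ r := by
    intro h
    rw [h, dist_self] at hpd
    omega
  have hwalk : ∀ y, y ≠ p d → ∃ w : G.Walk y x, p d ∉ w.support := by
    intro y hy
    obtain ⟨w, hw⟩ := hG.1.exists_walk_length_eq_dist y x
    have hlen := h y x
    rw [← hw] at hlen
    refine ⟨w, ?_⟩
    match w, hlen with
    | .nil, _ => simpa using hx.symm
    | .cons _ .nil, _ => simpa using ⟨hy.symm, hx.symm⟩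
    | .cons (v := m) h1 (.cons h2 .nil), _ =>
      simp only [Walk.support_cons, Walk.support_nil, List.mem_cons, List.not_mem_nil, or_false]
      rintro (h | h | h)
      · exact hy h.symm
      · exact hnadj (h ▸ h2)
      · exact hx h.symm
    | .cons _ (.cons _ (.cons _ _)), hlen => simp at hlen
  obtain ⟨w₁, hw₁⟩ := hwalk d hadj.ne
  obtain ⟨w₂, hw₂⟩ := hwalk r hcr.symm
  have := hG.dist_le_of_walk_avoiding hadj hpd (w₁.append w₂.reverse) (by
    rw [Walk.mem_support_append_iff, Walk.support_reverse, List.mem_reverse]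
    exact not_or.2 ⟨hw₁, hw₂⟩)
  rw [SimpleGraph.dist_self] at this
  omega

/-- If every `k`-subset of a block graph extends to a connected set by adding at most one vertex,
then the diameter is at most two. -/
lemma dist_le_two_of_connected_superset [Fintype V] (hG : IsBlockGraph G) {k : ℕ} (hk : 2 ≤ k)
    (hk' : k + 2 ≤ Fintype.card V)
    (h : ∀ S : Finset V, #S = k →
      ∃ W : Set V, (S : Set V) ⊆ W ∧ (G.induce W).Connected ∧ W.ncard ≤ k + 1) (r d : V) :
    G.dist r d ≤ 2 := by
  by_contra! hlt
  obtain ⟨p, hp⟩ := hG.1.exists_parent r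
  have hne : ∀ y, 0 < G.dist r y → y ≠ r := by
    rintro y hy rfl
    simp at hy
  obtain ⟨hc, hcd⟩ := hp d (hne d (by omega))
  obtain ⟨hb, hbd⟩ := hp (p d) (hne _ (by omega))
  have hne1 : ∀ {x y : V}, G.dist r x ≠ G.dist r y → x ≠ y := fun h h' => h (h' ▸ rfl)
  have hrr : G.dist r r = 0 := dist_self
  have hsub : ({r, d} : Finset V) ⊆ (univ.erase (p d)).erase (p (p d)) := by
    intro x hx
    simp only [Finset.mem_insert, Finset.mem_singleton] at hx
    simp only [mem_erase, mem_univ, and_true]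
    rcases hx with rfl | rfl <;> constructor <;> apply hne1 <;> omega
  have hcard2 : #({r, d} : Finset V) ≤ k := card_le_two.trans hk
  have hcard : k ≤ #((univ.erase (p d)).erase (p (p d))) := by
    rw [card_erase_of_mem (mem_erase.2 ⟨hne1 (by omega), mem_univ _⟩),
      card_erase_of_mem (mem_univ _), card_univ]
    omega
  obtain ⟨S, hS1, hS2, hSk⟩ := exists_subsuperset_card_eq hsub hcard2 hcard
  obtain ⟨W, hSW, hW, hWk⟩ := h S hSk
  have hrW : r ∈ W := hSW (hS1 (by simp))
  have hdW : d ∈ W := hSW (hS1 (by simp))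
  have hcW : p d ∈ W := by
    by_contra hcW
    have := hG.dist_le_of_connected hW hc hcd hdW hrW hcW
    omega
  have hbW : p (p d) ∈ W := by
    by_contra hbW
    have := hG.dist_le_of_connected hW hb hbd hcW hrW hbW
    omega
  have hbig : ((insert (p d) (insert (p (p d)) S) : Finset V) : Set V) ⊆ W := by
    simp only [coe_insert, Set.insert_subset_iff]
    exact ⟨hcW, hbW, hSW⟩
  have hle := Set.ncard_le_ncard hbig
  have hbS : p (p d) ∉ S := fun h => (mem_erase.1 (hS2 h)).1 rfl
  have hcS : p d ∉ insert (p (p d)) S := by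
    rw [Finset.mem_insert, not_or]
    exact ⟨hb.ne, fun h => (mem_erase.1 (mem_erase.1 (hS2 h)).2).1 rfl⟩
  rw [Set.ncard_coe_finset, card_insert_of_notMem hcS, card_insert_of_notMem hbS] at hle
  omega

end IsBlockGraph

namespace SimpleGraph

variable {V : Type*} {G : SimpleGraph V}

/-- The Steiner distance of a vertex set is at least its cardinality minus one, with equality
only for connected sets. -/
lemma card_le_steinerDist_add [Finite V] (hG : G.Connected) (S : Finset V) :
    #S ≤ steinerDist G S + if (G.induce (S : Set V)).Connected then 1 else 0 := by
  obtain ⟨W, hSW, hW, hcard⟩ := exists_connected_superset_ncard_le hG (S : Set V)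
  have hle := Set.ncard_le_ncard hSW
  rw [Set.ncard_coe_finset] at hle
  split_ifs with hS
  · omega
  · by_contra! hlt
    refine hS ?_
    rwa [Set.eq_of_subset_of_ncard_le hSW (by rw [Set.ncard_coe_finset]; omega)]

lemma steinerDist_add_le_card [Finite V] {v : V} (hv : ∀ u, u ≠ v → G.Adj v u) (S : Finset V) :
    (steinerDist G S + if (G.induce (S : Set V)).Connected then 1 else 0) ≤ #S := by
  split_ifs with hS
  · simpa [Set.ncard_coe_finset] using steinerDist_add_one_le_ncard subset_rfl hS
  · have hconn : (G.induce ((insert v S : Finset V) : Set V)).Connected := by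
      refine induce_connected_of_walks (a := v) (by simp) fun b hb => ?_
      by_cases hbv : b = v
      · subst hbv
        exact ⟨.nil, by simp⟩
      · refine ⟨(hv b hbv).toWalk, ?_⟩
        simpa [Adj.toWalk, hbv] using hb
    have h := steinerDist_add_one_le_ncard (S := (S : Set V)) (by simp) hconn
    rw [Set.ncard_coe_finset] at h
    have := card_insert_le v S
    omega

lemma steinerWiener_add_card_connected [Fintype V] (G : SimpleGraph V) (k : ℕ) :
    steinerWiener G k +
        #((powersetCard k univ).filter fun S : Finset V => (G.induce (S : Set V)).Connected) =
      ∑ S ∈ powersetCard k (univ : Finset V),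
        (steinerDist G S + if (G.induce (S : Set V)).Connected then 1 else 0) := by
  rw [steinerWiener, sum_add_distrib, card_filter]

end SimpleGraph

lemma Nat.choose_mul_eq_sub_one_mul_add {n k : ℕ} (hn : 0 < n) (hk : 0 < k) :
    n.choose k * k = (n - 1) * (n - 1).choose (k - 1) + (n - 1).choose (k - 1) := by
  obtain ⟨n, rfl⟩ := Nat.exists_eq_succ_of_ne_zero hn.ne'
  obtain ⟨k, rfl⟩ := Nat.exists_eq_succ_of_ne_zero hk.ne'
  rw [Nat.succ_eq_add_one, Nat.succ_eq_add_one, ← Nat.add_one_mul_choose_eq,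
    Nat.add_sub_cancel, Nat.add_sub_cancel]
  ring

/-- Sharp lower bound for the Steiner k-Wiener index of a block graph with given block
orders: (n-1)*C(n-1,k-1) - sum_i C(b_i-1,k) <= SW_k(G), with equality iff G is the
star-like block graph (has a universal vertex); stated additively. -/
theorem stmt16 {V : Type*} [Fintype V] (G : SimpleGraph V) (hbg : IsBlockGraph G)
    (t : ℕ) (Bl : Fin t → Set V) (hB : ∀ i, IsBlock G (Bl i))
    (hinj : Function.Injective Bl) (hall : ∀ C : Set V, IsBlock G C → ∃ i, C = Bl i)
    (k : ℕ) (hk : 2 ≤ k) (hk' : k < Fintype.card V - 1) :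
    (Fintype.card V - 1) * (Fintype.card V - 1).choose (k - 1) ≤
        steinerWiener G k + ∑ i : Fin t, ((Bl i).ncard - 1).choose k
    ∧ ((Fintype.card V - 1) * (Fintype.card V - 1).choose (k - 1) =
          steinerWiener G k + ∑ i : Fin t, ((Bl i).ncard - 1).choose k
        ↔ ∃ v : V, ∀ u : V, u ≠ v → G.Adj v u) := by
  have hc := hbg.card_connected_le hB hall hk
  have hsum := steinerWiener_add_card_connected G k
  have hpos : 0 < Fintype.card V := by omega
  have hch := Nat.choose_mul_eq_sub_one_mul_add hpos (show 0 < k by omega)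
  have hconst : ∑ _S ∈ powersetCard k (univ : Finset V), k = (Fintype.card V).choose k * k := by
    rw [sum_const, card_powersetCard, card_univ, smul_eq_mul]
  have hk_le : ∀ S ∈ powersetCard k (univ : Finset V),
      k ≤ steinerDist G S + if (G.induce (S : Set V)).Connected then 1 else 0 := fun S hS =>
    (mem_powersetCard.1 hS).2 ▸ card_le_steinerDist_add hbg.1 S
  have hge := sum_le_sum hk_le
  refine ⟨by omega, fun heq => ?_, fun ⟨v, hv⟩ => ?_⟩
  · have hsum_eq := (sum_eq_sum_iff_of_le hk_le).1 (by omega)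
    refine hbg.exists_universal_of_dist_le_two
      (hbg.dist_le_two_of_connected_superset hk (by omega) fun S hS => ?_)
    obtain ⟨W, hSW, hW, hWk⟩ := exists_connected_superset_ncard_le hbg.1 (S : Set V)
    have := hsum_eq S (mem_powersetCard.2 ⟨subset_univ S, hS⟩)
    exact ⟨W, hSW, hW, by omega⟩
  · have hc' := hbg.le_card_connected hv hB hinj hk
    have hle : ∑ S ∈ powersetCard k (univ : Finset V),
        (steinerDist G S + if (G.induce (S : Set V)).Connected then 1 else 0) ≤
          ∑ _S ∈ powersetCard k (univ : Finset V), k := sum_le_sum fun S hS =>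
      (mem_powersetCard.1 hS).2 ▸ steinerDist_add_le_card hv S
    omega
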